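/- arXiv:1412.2099 — 7 statements merged into one kernel-verified Lean document; each statement's English description precedes it below -/
import Mathlib

section
/- Let f⁺, f⁻ : ℝⁿ → ℝⁿ be continuous vector fields, let φ be a monotonic transition function and let ψ be a transition function. Then there exists a unique continuous map G : ℝⁿ × [−1,1] → ℝⁿ with G(x,1) = G(x,−1) = 0 for all x, such that for every x ∈ ℝⁿ and every s ∈ ℝ one has ((1+ψ(s))/2) f⁺(x) + ((1−ψ(s))/2) f⁻(x) = ((1+φ(s))/2) f⁺(x) + ((1−φ(s))/2) f⁻(x) + G(x, φ(s)). Explicitly, G(x,λ) = (ψ(φ⁻¹(λ)) − λ)(f⁺(x) − f⁻(x))/2, where φ⁻¹ : [−1,1] → [−1,1] is the inverse of the restriction of φ to [−1,1] (that restriction being a strictly increasing continuous bijection of [−1,1] onto itself). -/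
/-- A transition function: continuous on ℝ, C¹ on (−1,1), equal to sign(s) for |s| ≥ 1. -/
def IsTransitionFun (ψ : ℝ → ℝ) : Prop :=
  Continuous ψ ∧ ContDiffOn ℝ 1 ψ (Set.Ioo (-1 : ℝ) 1) ∧
  (∀ s : ℝ, 1 ≤ s → ψ s = 1) ∧ (∀ s : ℝ, s ≤ -1 → ψ s = -1)

/-- A monotonic transition function: a transition function with φ′(s) > 0 on (−1,1). -/
def IsMonotonicTransitionFun (φ : ℝ → ℝ) : Prop :=
  IsTransitionFun φ ∧ ∀ s ∈ Set.Ioo (-1 : ℝ) 1, 0 < deriv φ s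

open Set in
/-- A transition function is determined by its restriction to `[-1, 1]`. -/
lemma IsTransitionFun.apply_projIcc {ψ : ℝ → ℝ} (hψ : IsTransitionFun ψ) (s : ℝ) :
    ψ (projIcc (-1 : ℝ) 1 (by norm_num) s) = ψ s := by
  obtain ⟨-, -, h1, h2⟩ := hψ
  rcases le_total s (-1) with h | h
  · rw [projIcc_of_le_left _ h, h2 s h, h2 _ le_rfl]
  · rcases le_total 1 s with h' | h'
    · rw [projIcc_of_right_le _ h', h1 s h', h1 _ le_rfl]
    · rw [projIcc_of_mem _ ⟨h, h'⟩]

open Set in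
lemma IsMonotonicTransitionFun.strictMonoOn {φ : ℝ → ℝ} (hφ : IsMonotonicTransitionFun φ) :
    StrictMonoOn φ (Icc (-1) 1) :=
  strictMonoOn_of_deriv_pos (convex_Icc _ _) hφ.1.1.continuousOn
    (by rw [interior_Icc]; exact hφ.2)

open Set in
lemma IsMonotonicTransitionFun.bijOn {φ : ℝ → ℝ} (hφ : IsMonotonicTransitionFun φ) :
    BijOn φ (Icc (-1) 1) (Icc (-1) 1) := by
  have h1 : φ 1 = 1 := hφ.1.2.2.1 1 le_rfl
  have h2 : φ (-1) = -1 := hφ.1.2.2.2 (-1) le_rfl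
  refine ⟨fun s hs => ⟨?_, ?_⟩, hφ.strictMonoOn.injOn, ?_⟩
  · rw [← h2]
    exact hφ.strictMonoOn.monotoneOn (by simp) hs hs.1
  · rw [← h1]
    exact hφ.strictMonoOn.monotoneOn hs (by simp) hs.2
  · have := intermediate_value_Icc (by norm_num : (-1 : ℝ) ≤ 1) hφ.1.1.continuousOn
    rwa [h1, h2] at this

open Set in
/-- A monotonic transition function restricts to a homeomorphism of `[-1, 1]`. -/
lemma IsMonotonicTransitionFun.exists_homeomorph {φ : ℝ → ℝ} (hφ : IsMonotonicTransitionFun φ) :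
    ∃ e : Icc (-1 : ℝ) 1 ≃ₜ Icc (-1 : ℝ) 1, ∀ s, (e s : ℝ) = φ s := by
  have hc : Continuous (hφ.bijOn.equiv φ) :=
    (hφ.1.1.comp continuous_subtype_val).subtype_mk _
  exact ⟨hc.homeoOfEquivCompactToT2, fun _ => rfl⟩

/-- Equality of a linear and a nonlinear combination amounts to a formula for the hidden term. -/
lemma linearCombination_eq_add_iff {E : Type*} [AddCommGroup E] [Module ℝ E] (a b : ℝ)
    (u v g : E) :
    ((1 + a) / 2) • u + ((1 - a) / 2) • v = ((1 + b) / 2) • u + ((1 - b) / 2) • v + g ↔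
      g = ((a - b) / 2) • (u - v) := by
  have key : ((1 + a) / 2) • u + ((1 - a) / 2) • v =
      ((1 + b) / 2) • u + ((1 - b) / 2) • v + ((a - b) / 2) • (u - v) := by
    module
  rw [key, add_right_inj, eq_comm]

theorem stmt0 (n : ℕ) (fp fm : (Fin n → ℝ) → (Fin n → ℝ))
    (hfp : Continuous fp) (hfm : Continuous fm)
    (φ ψ : ℝ → ℝ) (hφ : IsMonotonicTransitionFun φ) (hψ : IsTransitionFun ψ) :
    (∃! G : (Fin n → ℝ) × Set.Icc (-1 : ℝ) 1 → (Fin n → ℝ),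
      Continuous G ∧
      (∀ x : Fin n → ℝ,
        G (x, ⟨1, by norm_num⟩) = 0 ∧ G (x, ⟨-1, by norm_num⟩) = 0) ∧
      (∀ (x : Fin n → ℝ) (s : ℝ) (hs : φ s ∈ Set.Icc (-1 : ℝ) 1),
        ((1 + ψ s) / 2) • fp x + ((1 - ψ s) / 2) • fm x =
          ((1 + φ s) / 2) • fp x + ((1 - φ s) / 2) • fm x + G (x, ⟨φ s, hs⟩))) ∧
    (∀ G : (Fin n → ℝ) × Set.Icc (-1 : ℝ) 1 → (Fin n → ℝ),
      (Continuous G ∧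
        (∀ x : Fin n → ℝ,
          G (x, ⟨1, by norm_num⟩) = 0 ∧ G (x, ⟨-1, by norm_num⟩) = 0) ∧
        (∀ (x : Fin n → ℝ) (s : ℝ) (hs : φ s ∈ Set.Icc (-1 : ℝ) 1),
          ((1 + ψ s) / 2) • fp x + ((1 - ψ s) / 2) • fm x =
            ((1 + φ s) / 2) • fp x + ((1 - φ s) / 2) • fm x + G (x, ⟨φ s, hs⟩))) →
      ∀ φinv : ℝ → ℝ,
        (∀ l ∈ Set.Icc (-1 : ℝ) 1, φinv l ∈ Set.Icc (-1 : ℝ) 1 ∧ φ (φinv l) = l) →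
        (∀ s ∈ Set.Icc (-1 : ℝ) 1, φinv (φ s) = s) →
        ∀ (x : Fin n → ℝ) (l : ℝ) (hl : l ∈ Set.Icc (-1 : ℝ) 1),
          G (x, ⟨l, hl⟩) = ((ψ (φinv l) - l) / 2) • (fp x - fm x)) := by
  simp only [linearCombination_eq_add_iff]
  obtain ⟨e, he⟩ := hφ.exists_homeomorph
  have hesymm : ∀ l, φ (e.symm l) = l := fun l => by rw [← he, e.apply_symm_apply]
  have hend : ∀ l : Set.Icc (-1 : ℝ) 1, ∀ s : Set.Icc (-1 : ℝ) 1, φ s = l → e.symm l = s :=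
    fun l s h => e.symm_apply_eq.2 (Subtype.ext (by rw [he, h]))
  refine ⟨⟨fun p => ((ψ (e.symm p.2) - p.2) / 2) • (fp p.1 - fm p.1), ⟨?_, ?_, ?_⟩, ?_⟩, ?_⟩
  · have := hψ.1
    fun_prop
  · intro x
    constructor
    · simp [hend ⟨1, by norm_num⟩ ⟨1, by norm_num⟩ (hφ.1.2.2.1 1 le_rfl), hψ.2.2.1 1 le_rfl]
    · simp [hend ⟨-1, by norm_num⟩ ⟨-1, by norm_num⟩ (hφ.1.2.2.2 (-1) le_rfl),
        hψ.2.2.2 (-1) le_rfl]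
  · intro x s hs
    simp only [hend ⟨φ s, hs⟩ (Set.projIcc (-1) 1 (by norm_num) s) (hφ.1.apply_projIcc s),
      hψ.apply_projIcc]
  · rintro G ⟨-, -, hG⟩
    funext ⟨x, l⟩
    have h := hG x (e.symm l) (by rw [hesymm]; exact l.2)
    simpa only [hesymm] using h
  · rintro G ⟨-, -, hG⟩ φinv hinv - x l hl
    have h := hG x (φinv l) (by rw [(hinv l hl).2]; exact hl)
    simpa only [(hinv l hl).2] using h
end

section
/- Let F : ℝⁿ → ℝⁿ be C³, let h : ℝⁿ → ℝ be C¹ with ∇h nonvanishing, and let p ∈ ℝⁿ satisfy h(p) = 0 and F(p)·∇h(p) = 0. Define K^ε(p,λ) = ((1+λ)/2) F(p + ε∇h(p))·∇h(p) + ((1−λ)/2) F(p − ε∇h(p))·∇h(p), and let A(p) = (DF(p)[∇h(p)])·∇h(p), where DF(p) is the Fréchet derivative of F at p. If A(p) ≠ 0, then there exist ε₁ > 0 and a continuous function λ* : [0,ε₁) → (−1,1) with λ*(0) = 0 such that K^ε(p, λ*(ε)) = 0 for all ε ∈ [0,ε₁). In other words, the trivial hidden term G ≡ 0 completes the extrinsically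 pinched system at p. -/
open Matrix

/-- If a differentiable function `g` vanishes at `0` with nonzero derivative there, the convex
combination of `g ε` and `g (-ε)` can be made to vanish by a weight depending continuously on `ε`,
equal to `0` at `ε = 0`. -/
theorem exists_continuousOn_weight_combination_eq_zero {g : ℝ → ℝ} (hg : Differentiable ℝ g)
    (hg0 : g 0 = 0) (hd : deriv g 0 ≠ 0) :
    ∃ δ : ℝ, 0 < δ ∧ ∃ lam : ℝ → ℝ,
      ContinuousOn lam (Set.Ico 0 δ) ∧ lam 0 = 0 ∧
      ∀ ε ∈ Set.Ico (0 : ℝ) δ, lam ε ∈ Set.Ioo (-1 : ℝ) 1 ∧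
        ((1 + lam ε) / 2) * g ε + ((1 - lam ε) / 2) * g (-ε) = 0 := by
  set q := dslope g 0
  have hq : Continuous q := by
    refine continuous_iff_continuousAt.2 fun b => ?_
    rcases eq_or_ne b 0 with rfl | hb
    · exact continuousAt_dslope_same.2 (hg 0)
    · exact (continuousAt_dslope_of_ne hb).2 (hg b).continuousAt
  have hq0 : q 0 + q (-0) ≠ 0 := by
    simpa [q, ← two_mul] using hd
  have hgq (t : ℝ) : g t = t * q t := by
    simpa [hg0] using (sub_smul_dslope g 0 t).symm
  have hsum : Continuous fun t => q t + q (-t) := by fun_prop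
  have hdiff : Continuous fun t => q (-t) - q t := by fun_prop
  set lam : ℝ → ℝ := fun t => (q (-t) - q t) / (q t + q (-t))
  have hlam (t : ℝ) (ht : q t + q (-t) ≠ 0) : ContinuousAt lam t :=
    hdiff.continuousAt.div hsum.continuousAt ht
  have hlam0 : lam 0 = 0 := by simp [lam]
  have hnear : ∀ᶠ t in nhds 0, q t + q (-t) ≠ 0 ∧ lam t ∈ Set.Ioo (-1 : ℝ) 1 :=
    (hsum.continuousAt.eventually_ne hq0).and
      ((hlam 0 hq0).eventually_mem (Ioo_mem_nhds (by simp [hlam0]) (by simp [hlam0])))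
  obtain ⟨δ, hδ, hball⟩ := Metric.eventually_nhds_iff.1 hnear
  have hIco {t : ℝ} (ht : t ∈ Set.Ico 0 δ) := hball (y := t) (by
    simpa [abs_of_nonneg ht.1] using ht.2)
  refine ⟨δ, hδ, lam, fun t ht => (hlam t (hIco ht).1).continuousWithinAt, hlam0,
    fun t ht => ⟨(hIco ht).2, ?_⟩⟩
  have hne := (hIco ht).1
  rw [hgq t, hgq (-t)]
  simp only [lam]
  field_simp
  ring

theorem stmt7 (n : ℕ) (F : (Fin n → ℝ) → (Fin n → ℝ)) (hF : ContDiff ℝ 3 F)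
    (h : (Fin n → ℝ) → ℝ) (hh : ContDiff ℝ 1 h)
    (gradh : (Fin n → ℝ) → (Fin n → ℝ))
    (hgrad : ∀ x w, fderiv ℝ h x w = gradh x ⬝ᵥ w)
    (hgrad0 : ∀ x, gradh x ≠ 0)
    (p : Fin n → ℝ) (hp : h p = 0) (hpF : F p ⬝ᵥ gradh p = 0)
    (hA : fderiv ℝ F p (gradh p) ⬝ᵥ gradh p ≠ 0) :
    ∃ ε₁ : ℝ, 0 < ε₁ ∧ ∃ lam : ℝ → ℝ,
      ContinuousOn lam (Set.Ico 0 ε₁) ∧ lam 0 = 0 ∧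
      ∀ ε ∈ Set.Ico (0 : ℝ) ε₁, lam ε ∈ Set.Ioo (-1 : ℝ) 1 ∧
        ((1 + lam ε) / 2) * (F (p + ε • gradh p) ⬝ᵥ gradh p) +
          ((1 - lam ε) / 2) * (F (p - ε • gradh p) ⬝ᵥ gradh p) = 0 := by
  set v := gradh p
  have hF1 : Differentiable ℝ F := hF.differentiable (by norm_num)
  have hderiv (t : ℝ) :
      HasDerivAt (fun s : ℝ => F (p + s • v) ⬝ᵥ v) (fderiv ℝ F (p + t • v) v ⬝ᵥ v) t := by
    have hline : HasDerivAt (fun s : ℝ => p + s • v) v t := by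
      simpa using ((hasDerivAt_id t).smul_const v).const_add p
    have hcomp := hasDerivAt_pi.1 ((hF1 (p + t • v)).hasFDerivAt.comp_hasDerivAt t hline)
    exact HasDerivAt.fun_sum fun i _ => (hcomp i).mul_const (v i)
  simpa [sub_eq_add_neg] using exists_continuousOn_weight_combination_eq_zero
    (fun t => (hderiv t).differentiableAt) (by simpa using hpF)
    (by rw [(hderiv 0).deriv]; simpa using hA)
end

section
/- Let F : ℝⁿ → ℝⁿ be C³, let h : ℝⁿ → ℝ be C¹ with ∇h nonvanishing, and let p ∈ ℝⁿ satisfy h(p) = 0 and F(p)·∇h(p) = 0. Define K^ε(p,λ) = ((1+λ)/2) F(p + ε∇h(p))·∇h(p) + ((1−λ)/2) F(p − ε∇h(p))·∇h(p). Suppose A(p) = (DF(p)[∇h(p)])·∇h(p) = 0 and B(p) = (D²F(p)[∇h(p), ∇h(p)])·∇h(p) ≠ 0, where DF and D²F are the first and second Fréchet derivatives of F. Then there exists ε₁ > 0 such that for every ε ∈ (0,ε₁) there is no λ ∈ [−1,1] with K^ε(p,λ) = 0. In other words, the trivial hidden term G ≡ 0 does not complete the extrinsically pinched system at p: the pinched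 system has only crossing at p for all sufficiently small ε > 0. -/
open Matrix Set Filter Topology

/-- A differentiable function with `f 0 = f' 0 = 0` and `f'' 0 > 0` is positive just to the right
of `0`. -/
lemma eventually_pos_of_deriv_deriv_pos {f f' : ℝ → ℝ} {b : ℝ} (hf : ∀ t, HasDerivAt f (f' t) t)
    (hf' : HasDerivAt f' b 0) (h0 : f 0 = 0) (h0' : f' 0 = 0) (hb : 0 < b) :
    ∀ᶠ t in 𝓝[>] (0 : ℝ), 0 < f t := by
  have hslope : ∀ᶠ t in 𝓝[>] (0 : ℝ), 0 < slope f' 0 t :=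
    ((hasDerivAt_iff_tendsto_slope.1 hf').mono_left
      (nhdsWithin_mono _ fun _ ht => ne_of_gt ht)).eventually (lt_mem_nhds hb)
  obtain ⟨δ, hδ, hpos⟩ := mem_nhdsGT_iff_exists_Ioo_subset.1 hslope
  filter_upwards [Ioo_mem_nhdsGT hδ] with t ht
  obtain ⟨c, hc, hceq⟩ := exists_hasDerivAt_eq_slope f f' ht.1
    (fun x _ => (hf x).continuousAt.continuousWithinAt) (fun x _ => hf x)
  have hcpos : 0 < slope f' 0 c := hpos ⟨hc.1, hc.2.trans ht.2⟩
  rw [slope_def_field, h0', sub_zero, sub_zero, hceq, h0, sub_zero, sub_zero] at hcpos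
  exact (div_pos_iff_of_pos_right ht.1).1 ((div_pos_iff_of_pos_right hc.1).1 hcpos)

/-- A scalar observable of a `C²` map along a ray is positive near the base point if it vanishes to
first order there and has positive second derivative. -/
lemma eventually_pos_along_ray {E E' : Type*} [NormedAddCommGroup E] [NormedSpace ℝ E]
    [NormedAddCommGroup E'] [NormedSpace ℝ E'] {F : E → E'} (hF : ContDiff ℝ 2 F)
    (L : E' →L[ℝ] ℝ) (p w : E) (h0 : L (F p) = 0) (h1 : L (fderiv ℝ F p w) = 0)
    (h2 : 0 < L (fderiv ℝ (fderiv ℝ F) p w w)) :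
    ∀ᶠ t in 𝓝[>] (0 : ℝ), 0 < L (F (p + t • w)) := by
  have hline (t : ℝ) : HasDerivAt (fun t : ℝ => p + t • w) w t := by
    simpa using ((hasDerivAt_id t).smul_const w).const_add p
  have hd : Differentiable ℝ F := hF.differentiable (by norm_num)
  have hd' : Differentiable ℝ (fderiv ℝ F) :=
    (hF.fderiv_right (m := 1) (by norm_num)).differentiable (by norm_num)
  refine eventually_pos_of_deriv_deriv_pos (f' := fun t => L (fderiv ℝ F (p + t • w) w))
    (fun t => L.hasFDerivAt.comp_hasDerivAt t
      ((hd _).hasFDerivAt.comp_hasDerivAt t (hline t))) ?_ (by simpa using h0)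
    (by simpa using h1) h2
  have h := (hd' (p + (0 : ℝ) • w)).hasFDerivAt.comp_hasDerivAt (0 : ℝ) (hline 0)
  have h' := L.hasFDerivAt.comp_hasDerivAt (0 : ℝ) (h.clm_apply (hasDerivAt_const (0 : ℝ) w))
  simpa [Function.comp_def] using h'

theorem stmt8 (n : ℕ) (F : (Fin n → ℝ) → (Fin n → ℝ)) (hF : ContDiff ℝ 3 F)
    (h : (Fin n → ℝ) → ℝ) (hh : ContDiff ℝ 1 h)
    (gradh : (Fin n → ℝ) → (Fin n → ℝ))
    (hgrad : ∀ x w, fderiv ℝ h x w = gradh x ⬝ᵥ w)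
    (hgrad0 : ∀ x, gradh x ≠ 0)
    (p : Fin n → ℝ) (hp : h p = 0) (hpF : F p ⬝ᵥ gradh p = 0)
    (hA : fderiv ℝ F p (gradh p) ⬝ᵥ gradh p = 0)
    (hB : iteratedFDeriv ℝ 2 F p ![gradh p, gradh p] ⬝ᵥ gradh p ≠ 0) :
    ∃ ε₁ : ℝ, 0 < ε₁ ∧ ∀ ε : ℝ, 0 < ε → ε < ε₁ →
      ∀ l ∈ Set.Icc (-1 : ℝ) 1,
        ((1 + l) / 2) * (F (p + ε • gradh p) ⬝ᵥ gradh p) +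
          ((1 - l) / 2) * (F (p - ε • gradh p) ⬝ᵥ gradh p) ≠ 0 := by
  set v := gradh p
  set B := iteratedFDeriv ℝ 2 F p ![v, v] ⬝ᵥ v with hBdef
  have hB2 : fderiv ℝ (fderiv ℝ F) p v v ⬝ᵥ v = B := by
    simp [hBdef, iteratedFDeriv_two_apply]
  let L : (Fin n → ℝ) →L[ℝ] ℝ :=
    LinearMap.toContinuousLinearMap (B • (dotProductBilin ℝ ℝ).flip v)
  have hL (x : Fin n → ℝ) : L x = B * (x ⬝ᵥ v) := rfl
  have hF2 : ContDiff ℝ 2 F := hF.of_le (by norm_num)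
  have hBB : 0 < B * B := mul_self_pos.2 hB
  have hpos := eventually_pos_along_ray hF2 L p v (by simp [hL, hpF]) (by simp [hL, hA])
    (by rwa [hL, hB2])
  have hneg := eventually_pos_along_ray hF2 L p (-v) (by simp [hL, hpF]) (by simp [hL, hA])
    (by simpa [hL, hB2] using hBB)
  obtain ⟨ε₁, hε₁, hε⟩ := mem_nhdsGT_iff_exists_Ioo_subset.1 (hpos.and hneg)
  refine ⟨ε₁, hε₁, fun ε h0 h1 l hl hK => ?_⟩
  obtain ⟨hKpos, hKneg⟩ := hε ⟨h0, h1⟩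
  rw [smul_neg, ← sub_eq_add_neg] at hKneg
  rw [hL] at hKpos hKneg
  have hcomb := (convex_Ioi (0 : ℝ)) hKpos hKneg (a := (1 + l) / 2) (b := (1 - l) / 2)
    (by linarith [hl.1]) (by linarith [hl.2]) (by ring)
  rw [mem_Ioi, smul_eq_mul, smul_eq_mul, mul_left_comm, mul_left_comm ((1 - l) / 2), ← mul_add,
    hK, mul_zero] at hcomb
  exact lt_irrefl _ hcomb
end

section
/- Let U ⊆ ℝ^{n−1} be open, let F₁ : ℝ × U × ℝ → ℝ be C¹, let F_y : ℝ × U × ℝ → ℝ^{n−1} be continuous, and let μ : [0,ε₀) → ℝ be differentiable at 0 with μ(0) = 0. Suppose m : U → ℝ and a family m_ε : U → ℝ (ε ∈ [0,ε₀)), each differentiable in y, satisfy: m₀ ≡ 0; for each y ∈ U the map ε ↦ m_ε(y) is differentiable at ε = 0 with derivative m(y); for each y ∈ U the gradient ∇_y m_ε(y) tends to 0 as ε → 0⁺. Assume the invariance identity F₁(m_ε(y), y; μ(ε)) = μ(ε) ⟨∇_y m_ε(y), F_y(m_ε(y), y; μ(ε))⟩ holds for all ε ∈ [0,ε₀) and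 y ∈ U (i.e. the graph x₁ = m_ε(y) is invariant under ẋ₁ = F₁(x₁,y;μ(ε)), ẏ = μ(ε) F_y(x₁,y;μ(ε))). Then for every y ∈ U: μ′(0) (∂F₁/∂μ)(0,y;0) + m(y) (∂F₁/∂x₁)(0,y;0) = 0. -/
theorem stmt10 (m : ℕ) (U : Set (Fin m → ℝ)) (hU : IsOpen U)
    (F1 : ℝ → (Fin m → ℝ) → ℝ → ℝ)
    (hF1 : ContDiff ℝ 1 (fun z : ℝ × (Fin m → ℝ) × ℝ => F1 z.1 z.2.1 z.2.2))
    (Fy : ℝ → (Fin m → ℝ) → ℝ → (Fin m → ℝ))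
    (hFy : Continuous (fun z : ℝ × (Fin m → ℝ) × ℝ => Fy z.1 z.2.1 z.2.2))
    (ε₀ : ℝ) (hε₀ : 0 < ε₀)
    (μ : ℝ → ℝ) (μd : ℝ) (hμ0 : μ 0 = 0)
    (hμd : HasDerivWithinAt μ μd (Set.Ico 0 ε₀) 0)
    (M : ℝ → (Fin m → ℝ) → ℝ) (mc : (Fin m → ℝ) → ℝ)
    -- m₀ ≡ 0
    (hM0 : ∀ y ∈ U, M 0 y = 0)
    -- each m_ε is differentiable in y
    (hMydiff : ∀ ε ∈ Set.Ico (0 : ℝ) ε₀, ∀ y ∈ U, DifferentiableAt ℝ (M ε) y)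
    -- ε ↦ m_ε(y) is differentiable at ε = 0 with derivative m(y)
    (hMd : ∀ y ∈ U, HasDerivWithinAt (fun ε => M ε y) (mc y) (Set.Ico 0 ε₀) 0)
    -- ∇_y m_ε(y) → 0 as ε → 0⁺
    (hMgrad : ∀ y ∈ U, Filter.Tendsto (fun ε => fderiv ℝ (M ε) y)
      (nhdsWithin 0 (Set.Ioi 0)) (nhds 0))
    -- invariance identity: the graph x₁ = m_ε(y) is invariant
    (hinv : ∀ ε ∈ Set.Ico (0 : ℝ) ε₀, ∀ y ∈ U,
      F1 (M ε y) y (μ ε) = μ ε * fderiv ℝ (M ε) y (Fy (M ε y) y (μ ε))) :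
    ∀ y ∈ U,
      μd * deriv (fun s => F1 0 y s) 0 + mc y * deriv (fun x => F1 x y 0) 0 = 0 := by
  intro y hy
  have hIco : Set.Ico (0 : ℝ) ε₀ ∈ nhdsWithin 0 (Set.Ioi 0) := Ico_mem_nhdsGT_of_mem ⟨le_rfl, hε₀⟩
  have hμ := hμd.mono_of_mem_nhdsWithin hIco
  have hM := (hMd y hy).mono_of_mem_nhdsWithin hIco
  have hMy0 := hM0 y hy
  set F : ℝ × (Fin m → ℝ) × ℝ → ℝ := fun z => F1 z.1 z.2.1 z.2.2
  have hFd : HasFDerivAt F (fderiv ℝ F (0, y, 0)) (0, y, 0) :=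
    (hF1.differentiable one_ne_zero _).hasFDerivAt
  set D := fderiv ℝ F (0, y, 0)
  have hs : HasDerivAt (fun s => F1 0 y s) (D (0, 0, 1)) 0 :=
    hFd.comp_hasDerivAt (f := fun s : ℝ => ((0 : ℝ), y, s)) (0 : ℝ)
      ((hasDerivAt_const _ _).prodMk ((hasDerivAt_const _ _).prodMk (hasDerivAt_id _)))
  have hx : HasDerivAt (fun x => F1 x y 0) (D (1, 0, 0)) 0 :=
    hFd.comp_hasDerivAt (f := fun x : ℝ => (x, y, (0 : ℝ))) (0 : ℝ)
      ((hasDerivAt_id _).prodMk ((hasDerivAt_const _ _).prodMk (hasDerivAt_const _ _)))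
  have hcurve : HasDerivWithinAt (fun ε => (M ε y, y, μ ε)) (mc y, 0, μd) (Set.Ioi 0) 0 :=
    hM.prodMk ((hasDerivWithinAt_const _ _ _).prodMk hμ)
  have hcurve0 : (M 0 y, y, μ 0) = (0, y, 0) := by rw [hMy0, hμ0]
  have hh : HasDerivWithinAt (fun ε => F1 (M ε y) y (μ ε)) (D (mc y, 0, μd)) (Set.Ioi 0) 0 :=
    (hcurve0 ▸ hFd : HasFDerivAt F D (M 0 y, y, μ 0)).comp_hasDerivWithinAt
      (f := fun ε => (M ε y, y, μ ε)) (0 : ℝ) hcurve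
  have hFyt : Filter.Tendsto (fun ε => Fy (M ε y) y (μ ε)) (nhdsWithin 0 (Set.Ioi 0))
      (nhds (Fy 0 y 0)) := by
    have h := (hFy.tendsto (M 0 y, y, μ 0)).comp hcurve.continuousWithinAt
    simpa only [hMy0, hμ0, Function.comp_def] using h
  have hg : Filter.Tendsto (fun ε => fderiv ℝ (M ε) y (Fy (M ε y) y (μ ε)))
      (nhdsWithin 0 (Set.Ioi 0)) (nhds 0) := by
    have h := isBoundedBilinearMap_apply (𝕜 := ℝ) (E := Fin m → ℝ) (F := ℝ)
      |>.continuous.tendsto (0, Fy 0 y 0) |>.comp ((hMgrad y hy).prodMk_nhds hFyt)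
    simpa [Function.comp_def] using h
  have hslope := (hasDerivWithinAt_iff_tendsto_slope' Set.self_notMem_Ioi).1 hh
  have hslopeμ := (hasDerivWithinAt_iff_tendsto_slope' Set.self_notMem_Ioi).1 hμ
  have hzero : D (mc y, 0, μd) = 0 := by
    rw [← mul_zero μd]
    refine tendsto_nhds_unique hslope ((hslopeμ.mul hg).congr' ?_)
    filter_upwards [hIco] with ε hε
    have h0 : F1 (M 0 y) y (μ 0) = 0 := by
      rw [hinv 0 ⟨le_rfl, hε₀⟩ y hy, hμ0, zero_mul]
    rw [slope_def_field, slope_def_field, h0, hinv ε hε y hy, hμ0]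
    ring
  have hsplit : ((mc y, 0, μd) : ℝ × (Fin m → ℝ) × ℝ) = μd • (0, 0, 1) + mc y • (1, 0, 0) := by
    simp
  rw [hsplit, map_add, map_smul, map_smul, smul_eq_mul, smul_eq_mul] at hzero
  rw [hs.deriv, hx.deriv, hzero]
end

section
/- Let U ⊆ ℝ^{n−1} be open, fix y ∈ U, let F₁ : ℝ × U × ℝ → ℝ be C², and let μ : [0,ε₀) → ℝ be C¹ with μ(0) = 0. Let M > 0 and define 𝒦(λ,ε) = ((1+λ)/2) F₁(εM, y; μ(ε)) + ((1−λ)/2) F₁(−εM, y; μ(ε)). Assume F₁(0,y;0) = 0, that a := (∂F₁/∂x₁)(0,y;0) ≠ 0, and that λ₀ := −μ′(0)(∂F₁/∂μ)(0,y;0)/(M a) satisfies |λ₀| < 1. Then there exist ε₁ ∈ (0,ε₀) and a continuous function λ* : [0,ε₁) → (−1,1) with λ*(0) = λ₀ such that 𝒦(λ*(ε), ε) = 0 for all ε ∈ [0,ε₁). -/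
open Filter Topology Set in
/-- The quotient of two functions with a common zero tends to the quotient of their derivatives there,
provided the denominator has nonzero derivative. -/
theorem HasDerivWithinAt.tendsto_div_of_eq_zero {f g : ℝ → ℝ} {f' g' x : ℝ} {s : Set ℝ}
    (hf : HasDerivWithinAt f f' s x) (hg : HasDerivWithinAt g g' s x)
    (hfx : f x = 0) (hgx : g x = 0) (hg' : g' ≠ 0) :
    Tendsto (fun t => f t / g t) (𝓝[s \ {x}] x) (𝓝 (f' / g')) := by
  refine ((hasDerivWithinAt_iff_tendsto_slope.1 hf).div
    (hasDerivWithinAt_iff_tendsto_slope.1 hg) hg').congr' ?_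
  filter_upwards [self_mem_nhdsWithin] with t ht
  have hne : t - x ≠ 0 := sub_ne_zero.2 ht.2
  simp only [Pi.div_apply, slope_def_field, hfx, hgx, sub_zero]
  field_simp

/-- Chain rule for a differentiable function of two variables along a curve `t ↦ (t * c, ν t)`. -/
theorem hasDerivWithinAt_comp_mul_curve {G : ℝ × ℝ → ℝ} (hG : DifferentiableAt ℝ G (0, 0))
    {ν : ℝ → ℝ} {ν' : ℝ} {s : Set ℝ} (hν : HasDerivWithinAt ν ν' s 0) (hν0 : ν 0 = 0) (c : ℝ) :
    HasDerivWithinAt (fun t => G (t * c, ν t))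
      (c * deriv (fun x => G (x, 0)) 0 + ν' * deriv (fun x => G (0, x)) 0) s 0 := by
  have hfst : HasDerivAt (fun x : ℝ => (x, (0 : ℝ))) (1, 0) 0 :=
    (hasDerivAt_id 0).prodMk (hasDerivAt_const (0 : ℝ) (0 : ℝ))
  have hsnd : HasDerivAt (fun x : ℝ => ((0 : ℝ), x)) (0, 1) 0 :=
    (hasDerivAt_const (0 : ℝ) (0 : ℝ)).prodMk (hasDerivAt_id 0)
  have hx : HasDerivAt (fun x => G (x, 0)) (fderiv ℝ G (0, 0) (1, 0)) 0 :=
    HasFDerivAt.comp_hasDerivAt (f := fun x : ℝ => (x, (0 : ℝ))) (0 : ℝ) hG.hasFDerivAt hfst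
  have hy : HasDerivAt (fun x => G (0, x)) (fderiv ℝ G (0, 0) (0, 1)) 0 :=
    HasFDerivAt.comp_hasDerivAt (f := fun x : ℝ => ((0 : ℝ), x)) (0 : ℝ) hG.hasFDerivAt hsnd
  have hcurve : HasDerivWithinAt (fun t => (t * c, ν t)) (1 * c, ν') s 0 :=
    ((hasDerivWithinAt_id 0 s).mul_const c).prodMk hν
  have hG' : HasFDerivAt G (fderiv ℝ G (0, 0)) (0 * c, ν 0) := by
    rw [zero_mul, hν0]; exact hG.hasFDerivAt
  refine (hG'.comp_hasDerivWithinAt (0 : ℝ) hcurve).congr_deriv ?_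
  have hsplit : ((1 * c, ν') : ℝ × ℝ) = c • (1, 0) + ν' • (0, 1) := by simp
  rw [hx.deriv, hy.deriv, hsplit, map_add, map_smul, map_smul, smul_eq_mul, smul_eq_mul]

theorem stmt11 (m : ℕ) (U : Set (Fin m → ℝ)) (hU : IsOpen U)
    (y : Fin m → ℝ) (hy : y ∈ U)
    (F1 : ℝ → (Fin m → ℝ) → ℝ → ℝ)
    (hF1 : ContDiff ℝ 2 (fun z : ℝ × (Fin m → ℝ) × ℝ => F1 z.1 z.2.1 z.2.2))
    (ε₀ : ℝ) (hε₀ : 0 < ε₀)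
    (μ : ℝ → ℝ) (hμC1 : ContDiffOn ℝ 1 μ (Set.Ico 0 ε₀)) (hμ0 : μ 0 = 0)
    (μd : ℝ) (hμd : HasDerivWithinAt μ μd (Set.Ico 0 ε₀) 0)
    (Mc : ℝ) (hMc : 0 < Mc)
    (hF10 : F1 0 y 0 = 0)
    (ha : deriv (fun x => F1 x y 0) 0 ≠ 0)
    (hlam0 : |(-(μd * deriv (fun s => F1 0 y s) 0)) / (Mc * deriv (fun x => F1 x y 0) 0)| < 1) :
    ∃ ε₁ : ℝ, 0 < ε₁ ∧ ε₁ < ε₀ ∧ ∃ lam : ℝ → ℝ,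
      ContinuousOn lam (Set.Ico 0 ε₁) ∧
      lam 0 = (-(μd * deriv (fun s => F1 0 y s) 0)) / (Mc * deriv (fun x => F1 x y 0) 0) ∧
      ∀ ε ∈ Set.Ico (0 : ℝ) ε₁, lam ε ∈ Set.Ioo (-1 : ℝ) 1 ∧
        ((1 + lam ε) / 2) * F1 (ε * Mc) y (μ ε) +
          ((1 - lam ε) / 2) * F1 (-(ε * Mc)) y (μ ε) = 0 := by
  set a := deriv (fun x => F1 x y 0) 0
  set b := deriv (fun s => F1 0 y s) 0
  set l := (-(μd * b)) / (Mc * a) with hl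
  have hG : ContDiff ℝ 2 (fun p : ℝ × ℝ => F1 p.1 y p.2) :=
    hF1.comp (contDiff_fst.prodMk (contDiff_const.prodMk contDiff_snd))
  have hGd : DifferentiableAt ℝ (fun p : ℝ × ℝ => F1 p.1 y p.2) (0, 0) :=
    (hG.differentiable (by norm_num)).differentiableAt
  have hGc : Continuous (fun p : ℝ × ℝ => F1 p.1 y p.2) := hG.continuous
  set P : ℝ → ℝ := fun ε => F1 (ε * Mc) y (μ ε) with hP_def
  set N : ℝ → ℝ := fun ε => F1 (-(ε * Mc)) y (μ ε) with hN_def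
  have hP : HasDerivWithinAt P (Mc * a + μd * b) (Set.Ico 0 ε₀) 0 :=
    hasDerivWithinAt_comp_mul_curve hGd hμd hμ0 Mc
  have hN : HasDerivWithinAt N (-Mc * a + μd * b) (Set.Ico 0 ε₀) 0 := by
    simpa only [hN_def, mul_neg] using hasDerivWithinAt_comp_mul_curve hGd hμd hμ0 (-Mc)
  have hP0 : P 0 = 0 := by simp [hP_def, hμ0, hF10]
  have hN0 : N 0 = 0 := by simp [hN_def, hμ0, hF10]
  have hMa : Mc * a ≠ 0 := mul_ne_zero hMc.ne' ha
  have hslope : Mc * a + μd * b - (-Mc * a + μd * b) ≠ 0 := by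
    intro h; apply hMa; linarith
  have hlim : Filter.Tendsto (fun ε => -(P ε + N ε) / (P ε - N ε))
      (nhdsWithin 0 (Set.Ico 0 ε₀ \ {0})) (nhds l) := by
    have h := HasDerivWithinAt.tendsto_div_of_eq_zero (hP.add hN).neg (hP.sub hN)
      (by simp [hP0, hN0]) (by simp [hP0, hN0]) hslope
    have hval : l = -(Mc * a + μd * b + (-Mc * a + μd * b)) /
        (Mc * a + μd * b - (-Mc * a + μd * b)) := by
      rw [hl, div_eq_div_iff hMa hslope]
      ring
    rw [hval]
    exact h
  have hne : ∀ᶠ ε in nhdsWithin 0 (Set.Ico 0 ε₀ \ {0}), P ε - N ε ≠ 0 := by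
    have h := hasDerivWithinAt_iff_tendsto_slope.1 (hP.sub hN)
    filter_upwards [h.eventually (eventually_ne_nhds hslope)] with ε hε h0
    apply hε
    simp only [slope_def_field, Pi.sub_apply, hP0, hN0, h0, sub_zero, zero_div]
  have hIoo : ∀ᶠ ε in nhdsWithin 0 (Set.Ico 0 ε₀ \ {0}),
      -(P ε + N ε) / (P ε - N ε) ∈ Set.Ioo (-1 : ℝ) 1 :=
    hlim.eventually (Ioo_mem_nhds (abs_lt.1 hlam0).1 (abs_lt.1 hlam0).2)
  obtain ⟨δ, hδ, hball⟩ := Metric.mem_nhdsWithin_iff.1 (hne.and hIoo)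
  have hgood : ∀ ε ∈ Set.Ico 0 (min δ (ε₀ / 2)), ε ≠ 0 →
      P ε - N ε ≠ 0 ∧ -(P ε + N ε) / (P ε - N ε) ∈ Set.Ioo (-1 : ℝ) 1 := by
    intro ε hε h0
    refine hball ⟨?_, ⟨hε.1, ?_⟩, h0⟩
    · rw [Metric.mem_ball, Real.dist_0_eq_abs, abs_of_nonneg hε.1]
      exact hε.2.trans_le (min_le_left _ _)
    · have := hε.2.trans_le (min_le_right _ _)
      linarith
  have hsub : Set.Ico 0 (min δ (ε₀ / 2)) ⊆ Set.Ico 0 ε₀ :=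
    Set.Ico_subset_Ico_right ((min_le_right _ _).trans (by linarith))
  have hμc : ContinuousOn μ (Set.Ico 0 (min δ (ε₀ / 2))) := hμC1.continuousOn.mono hsub
  have hPc : ContinuousOn P (Set.Ico 0 (min δ (ε₀ / 2))) :=
    hGc.comp_continuousOn ((continuousOn_id.mul continuousOn_const).prodMk hμc)
  have hNc : ContinuousOn N (Set.Ico 0 (min δ (ε₀ / 2))) :=
    hGc.comp_continuousOn ((continuousOn_id.mul continuousOn_const).neg.prodMk hμc)
  refine ⟨min δ (ε₀ / 2), lt_min hδ (by linarith), (min_le_right _ _).trans_lt (by linarith),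
    Function.update (fun ε => -(P ε + N ε) / (P ε - N ε)) 0 l, ?_, by simp, ?_⟩
  · rw [continuousOn_update_iff]
    refine ⟨fun ε hε => ?_, fun _ => hlim.mono_left (nhdsWithin_mono _ ?_)⟩
    · have hcont := ((hPc.add hNc).neg ε hε.1).div ((hPc.sub hNc) ε hε.1) (hgood ε hε.1 hε.2).1
      exact hcont.mono Set.sdiff_subset
    · exact Set.sdiff_subset_sdiff_left hsub
  · intro ε hε
    by_cases h0 : ε = 0
    · subst h0
      rw [Function.update_self]
      exact ⟨abs_lt.1 hlam0, by simp [hμ0, hF10]⟩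
    · obtain ⟨hd, hmem⟩ := hgood ε hε h0
      rw [Function.update_of_ne h0]
      refine ⟨hmem, ?_⟩
      change (1 + -(P ε + N ε) / (P ε - N ε)) / 2 * P ε
        + (1 - -(P ε + N ε) / (P ε - N ε)) / 2 * N ε = 0
      field_simp
      ring
end

section
/- Let U ⊆ ℝ^{n−1} be open, let F₁ : ℝ × U × ℝ → ℝ be C², let F_y : ℝ × U × ℝ → ℝ^{n−1} be continuous, and let μ : [0,ε₀) → ℝ be C² with μ(0) = μ′(0) = 0. Suppose m : U → ℝ and a family m_ε : U → ℝ (ε ∈ [0,ε₀)), each differentiable in y, satisfy: m₀ ≡ 0; for each y ∈ U the map ε ↦ m_ε(y) is C² at ε = 0 with first derivative m(y) at 0; for each y ∈ U the gradient ∇_y m_ε(y) tends to 0 as ε → 0⁺. Assume the invariance identity F₁(m_ε(y), y; μ(ε)) = μ(ε) ⟨∇_y m_ε(y), F_y(m_ε(y), y; μ(ε))⟩ holds for all ε ∈ [0,ε₀) and y ∈ U, and assume in addition F₁(0,y;0) = 0 and (∂F₁/∂x₁)(0,y;0) = 0 for all y ∈ U. Then for every y ∈ U: μ″(0) (∂F₁/∂μ)(0,y;0)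 + m(y)² (∂²F₁/∂x₁²)(0,y;0) = 0. -/
open Filter Topology Asymptotics in
/-- One-sided or two-sided second-order Taylor expansion at a critical zero, on a convex set. -/
theorem isLittleO_sub_half_mul_sq {s : Set ℝ} (hs : Convex ℝ s) (h0s : (0 : ℝ) ∈ s)
    {f f' : ℝ → ℝ} {c : ℝ} (hf : ∀ x ∈ s, HasDerivWithinAt f (f' x) s x)
    (hf' : HasDerivWithinAt f' c s 0) (h0 : f 0 = 0) (h0' : f' 0 = 0) :
    (fun x => f x - c / 2 * x ^ 2) =o[𝓝[s] 0] fun x => x ^ 2 := by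
  have hlin : (fun x => f' x - c * x) =o[𝓝[s] 0] fun x => x := by
    simpa [h0', mul_comm] using hf'.isLittleO
  refine IsLittleO.of_bound fun C hC => ?_
  obtain ⟨δ, hδ, hbound⟩ := Metric.mem_nhdsWithin_iff.1 (hlin.bound hC)
  filter_upwards [self_mem_nhdsWithin, mem_nhdsWithin_of_mem_nhds (Metric.ball_mem_nhds 0 hδ)]
    with x hxs hxδ
  have hder : ∀ t ∈ s ∩ Metric.closedBall 0 ‖x‖,
      HasDerivWithinAt (fun x => f x - c / 2 * x ^ 2) (f' t - c * t)
        (s ∩ Metric.closedBall 0 ‖x‖) t := by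
    intro t ht
    have hsq : HasDerivAt (fun x : ℝ => c / 2 * x ^ 2) (c * t) t :=
      ((hasDerivAt_pow 2 t).const_mul (c / 2)).congr_deriv (by push_cast; ring)
    exact ((hf t ht.1).mono Set.inter_subset_left).sub hsq.hasDerivWithinAt
  have hle : ∀ t ∈ s ∩ Metric.closedBall 0 ‖x‖, ‖f' t - c * t‖ ≤ C * ‖x‖ := by
    intro t ht
    have htx : ‖t‖ ≤ ‖x‖ := by simpa using ht.2
    have htδ : t ∈ Metric.ball (0 : ℝ) δ := by
      rw [mem_ball_zero_iff] at hxδ ⊢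
      exact htx.trans_lt hxδ
    exact (hbound ⟨htδ, ht.1⟩ : ‖f' t - c * t‖ ≤ C * ‖t‖).trans (by gcongr)
  have h := (hs.inter (convex_closedBall 0 ‖x‖)).norm_image_sub_le_of_norm_hasDerivWithin_le
    hder hle (x := 0) (y := x) ⟨h0s, by simp⟩ ⟨hxs, by simp⟩
  simpa [h0, pow_two, mul_assoc] using h

open Filter Topology Asymptotics in
/-- If `g` agrees with `a * u` up to `o(u)` and `u / v → L`, then `g / v → a * L`. -/
theorem tendsto_div_of_isLittleO_sub {l : Filter ℝ} {g u v : ℝ → ℝ} {a L : ℝ}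
    (hg : (fun x => g x - a * u x) =o[l] u) (hu : Tendsto (fun x => u x / v x) l (𝓝 L))
    (hv : ∀ᶠ x in l, v x ≠ 0) : Tendsto (fun x => g x / v x) l (𝓝 (a * L)) := by
  have huv : u =O[l] v := isBigO_of_div_tendsto_nhds (hv.mono fun x hx h => absurd h hx) L hu
  have h := (hg.trans_isBigO huv).tendsto_div_nhds_zero.add (hu.const_mul a)
  rw [zero_add] at h
  exact h.congr fun x => by ring


theorem stmt12 (m : ℕ) (U : Set (Fin m → ℝ)) (hU : IsOpen U)
    (F1 : ℝ → (Fin m → ℝ) → ℝ → ℝ)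
    (hF1 : ContDiff ℝ 2 (fun z : ℝ × (Fin m → ℝ) × ℝ => F1 z.1 z.2.1 z.2.2))
    (Fy : ℝ → (Fin m → ℝ) → ℝ → (Fin m → ℝ))
    (hFy : Continuous (fun z : ℝ × (Fin m → ℝ) × ℝ => Fy z.1 z.2.1 z.2.2))
    (ε₀ : ℝ) (hε₀ : 0 < ε₀)
    -- μ is C² on [0,ε₀) with μ(0) = μ′(0) = 0, second derivative μ″(0) = μdd
    (μ : ℝ → ℝ) (μd : ℝ → ℝ) (μdd : ℝ)
    (hμd : ∀ ε ∈ Set.Ico (0 : ℝ) ε₀, HasDerivWithinAt μ (μd ε) (Set.Ico 0 ε₀) ε)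
    (hμdc : ContinuousOn μd (Set.Ico 0 ε₀))
    (hμdd : HasDerivWithinAt μd μdd (Set.Ico 0 ε₀) 0)
    (hμ0 : μ 0 = 0) (hμd0 : μd 0 = 0)
    (M : ℝ → (Fin m → ℝ) → ℝ) (Md : ℝ → (Fin m → ℝ) → ℝ) (Mdd : (Fin m → ℝ) → ℝ)
    (mc : (Fin m → ℝ) → ℝ)
    -- m₀ ≡ 0
    (hM0 : ∀ y ∈ U, M 0 y = 0)
    -- each m_ε is differentiable in y
    (hMydiff : ∀ ε ∈ Set.Ico (0 : ℝ) ε₀, ∀ y ∈ U, DifferentiableAt ℝ (M ε) y)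
    -- ε ↦ m_ε(y) is C² at ε = 0 with first derivative m(y) at 0
    (hMd : ∀ y ∈ U, ∀ ε ∈ Set.Ico (0 : ℝ) ε₀,
      HasDerivWithinAt (fun e => M e y) (Md ε y) (Set.Ico 0 ε₀) ε)
    (hMd0 : ∀ y ∈ U, Md 0 y = mc y)
    (hMdd : ∀ y ∈ U, HasDerivWithinAt (fun e => Md e y) (Mdd y) (Set.Ico 0 ε₀) 0)
    -- ∇_y m_ε(y) → 0 as ε → 0⁺
    (hMgrad : ∀ y ∈ U, Filter.Tendsto (fun ε => fderiv ℝ (M ε) y)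
      (nhdsWithin 0 (Set.Ioi 0)) (nhds 0))
    -- invariance identity: the graph x₁ = m_ε(y) is invariant
    (hinv : ∀ ε ∈ Set.Ico (0 : ℝ) ε₀, ∀ y ∈ U,
      F1 (M ε y) y (μ ε) = μ ε * fderiv ℝ (M ε) y (Fy (M ε y) y (μ ε)))
    -- degeneracy assumptions
    (hF10 : ∀ y ∈ U, F1 0 y 0 = 0)
    (hFx : ∀ y ∈ U, deriv (fun x => F1 x y 0) 0 = 0) :
    ∀ y ∈ U,
      μdd * deriv (fun s => F1 0 y s) 0 +
        (mc y) ^ 2 * deriv (fun x => deriv (fun x' => F1 x' y 0) x) 0 = 0 := by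
  open Filter Topology Asymptotics in
  intro y hy
  have h0mem : (0 : ℝ) ∈ Set.Ico 0 ε₀ := ⟨le_rfl, hε₀⟩
  have hIco : ∀ᶠ ε in 𝓝[>] (0 : ℝ), ε ∈ Set.Ico 0 ε₀ :=
    mem_of_superset (Ioo_mem_nhdsGT hε₀) Set.Ioo_subset_Ico_self
  have hle : 𝓝[>] (0 : ℝ) ≤ 𝓝[Set.Ico 0 ε₀] 0 :=
    le_inf nhdsWithin_le_nhds (le_principal_iff.2 hIco)
  have hne : ∀ᶠ ε in 𝓝[>] (0 : ℝ), ε ≠ 0 := by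
    filter_upwards [self_mem_nhdsWithin] with ε hε using ne_of_gt hε
  have hne2 : ∀ᶠ ε in 𝓝[>] (0 : ℝ), ε ^ 2 ≠ 0 := hne.mono fun ε hε => pow_ne_zero 2 hε
  -- the coefficients of the expansions of `μ` and `M`
  have hμlim : Tendsto (fun ε => μ ε / ε ^ 2) (𝓝[>] 0) (𝓝 (μdd / 2)) := by
    have h := (isLittleO_sub_half_mul_sq (convex_Ico 0 ε₀) h0mem hμd hμdd hμ0 hμd0).mono hle
    simpa using tendsto_div_of_isLittleO_sub h
      (tendsto_const_nhds.congr' (hne2.mono fun ε hε => (div_self hε).symm)) hne2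
  have hM1 := hMd y hy 0 h0mem
  have hMlim : Tendsto (fun ε => M ε y / ε) (𝓝[>] 0) (𝓝 (mc y)) := by
    have h : (fun ε => M ε y - mc y * ε) =o[𝓝[>] 0] fun ε => ε := by
      simpa [hM0 y hy, hMd0 y hy, mul_comm] using hM1.isLittleO.mono hle
    simpa using tendsto_div_of_isLittleO_sub h
      (tendsto_const_nhds.congr' (hne.mono fun ε hε => (div_self hε).symm)) hne
  have hM2lim : Tendsto (fun ε => M ε y ^ 2 / ε ^ 2) (𝓝[>] 0) (𝓝 (mc y ^ 2)) := by
    simpa only [div_pow] using hMlim.pow 2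
  have hMzero : Tendsto (fun ε => M ε y) (𝓝[>] 0) (𝓝 0) := by
    simpa [ContinuousWithinAt, hM0 y hy] using hM1.continuousWithinAt.tendsto.mono_left hle
  have hμzero : Tendsto μ (𝓝[>] 0) (𝓝 0) := by
    simpa [hμ0] using (hμd 0 h0mem).continuousWithinAt.tendsto.mono_left hle
  -- the `x₁`-dependence of `F1` at `μ = 0`
  have hg : ContDiff ℝ 2 (fun x => F1 x y 0) :=
    hF1.comp (contDiff_id.prodMk (contDiff_const (c := (y, (0 : ℝ)))))
  have hg' : ContDiff ℝ 1 (deriv fun x => F1 x y 0) :=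
    (contDiff_succ_iff_deriv (n := 1) |>.1 hg).2.2
  have hx : (fun x => F1 x y 0 - deriv (fun x => deriv (fun x' => F1 x' y 0) x) 0 / 2 * x ^ 2)
      =o[𝓝 0] fun x => x ^ 2 := by
    simpa [nhdsWithin_univ] using isLittleO_sub_half_mul_sq convex_univ (Set.mem_univ 0)
      (fun x _ => ((hg.differentiable (by norm_num)) x).hasDerivAt.hasDerivWithinAt)
      ((hg'.differentiable (by norm_num)) 0).hasDerivAt.hasDerivWithinAt (hF10 y hy) (hFx y hy)
  have hxlim := tendsto_div_of_isLittleO_sub (hx.comp_tendsto hMzero) hM2lim hne2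
  -- the `μ`-dependence of `F1` near the critical manifold
  have hG : ContDiff ℝ 2 (fun p : ℝ × ℝ => F1 p.1 y p.2) :=
    hF1.comp (contDiff_fst.prodMk (contDiff_const.prodMk contDiff_snd))
  have hstrict := hG.contDiffAt.hasStrictFDerivAt (x := ((0 : ℝ), (0 : ℝ))) (by norm_num)
  have hb : HasDerivAt (fun s => F1 0 y s)
      (fderiv ℝ (fun p : ℝ × ℝ => F1 p.1 y p.2) (0, 0) (0, 1)) 0 :=
    hstrict.hasFDerivAt.comp_hasDerivAt (0 : ℝ)
      ((hasDerivAt_const (0 : ℝ) (0 : ℝ)).prodMk (hasDerivAt_id (0 : ℝ)))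
  have hpair : Tendsto (fun ε => ((M ε y, μ ε), (M ε y, (0 : ℝ)))) (𝓝[>] 0)
      (𝓝 (((0 : ℝ), (0 : ℝ)), ((0 : ℝ), (0 : ℝ)))) :=
    (hMzero.prodMk_nhds hμzero).prodMk_nhds (hMzero.prodMk_nhds tendsto_const_nhds)
  have hs : (fun ε => (F1 (M ε y) y (μ ε) - F1 (M ε y) y 0) - deriv (fun s => F1 0 y s) 0 * μ ε)
      =o[𝓝[>] 0] μ := by
    have h := hstrict.isLittleO.comp_tendsto hpair
    have hlin : ∀ t : ℝ, fderiv ℝ (fun p : ℝ × ℝ => F1 p.1 y p.2) (0, 0) (0, t)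
        = deriv (fun s => F1 0 y s) 0 * t := by
      intro t
      rw [hb.deriv, show ((0 : ℝ), t) = t • ((0 : ℝ), (1 : ℝ)) by simp, map_smul, smul_eq_mul,
        mul_comm]
    refine (h.congr_left fun ε => ?_).trans_isBigO (IsBigO.of_bound 1 ?_)
    · simp [← hlin, -map_sub]
    · simp [Prod.norm_def]
  have hslim := tendsto_div_of_isLittleO_sub hs hμlim hne2
  -- the drift term is of higher order
  have hFylim : Tendsto (fun ε => Fy (M ε y) y (μ ε)) (𝓝[>] 0) (𝓝 (Fy 0 y 0)) :=
    (hFy.tendsto (0, y, 0)).comp (hMzero.prodMk_nhds (tendsto_const_nhds.prodMk_nhds hμzero))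
  have hdrift : Tendsto (fun ε => μ ε / ε ^ 2 * fderiv ℝ (M ε) y (Fy (M ε y) y (μ ε)))
      (𝓝[>] 0) (𝓝 0) := by
    have h := (isBoundedBilinearMap_apply (𝕜 := ℝ) (E := Fin m → ℝ) (F := ℝ)).continuous.tendsto
      (0, Fy 0 y 0) |>.comp ((hMgrad y hy).prodMk_nhds hFylim)
    simpa using hμlim.mul h
  have heq := tendsto_nhds_unique (hslim.add hxlim) (hdrift.congr' (by
    filter_upwards [hIco] with ε hε
    have := hinv ε hε y hy
    rw [← add_div, sub_add_cancel, this]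
    ring))
  linarith
end

section
/- Let U ⊆ ℝ^{n−1} be open, fix y ∈ U, let F₁ : ℝ × U × ℝ → ℝ be C², and let μ : [0,ε₀) → ℝ be C² with μ(0) = μ′(0) = 0. Assume F₁(0,y;0) = 0 and (∂F₁/∂x₁)(0,y;0) = 0, and set B := (∂²F₁/∂x₁²)(0,y;0). Let M > 0 and m ∈ ℝ satisfy B ≠ 0, 0 < |m| < M, and μ″(0)(∂F₁/∂μ)(0,y;0) + m² B = 0. Define the completed pinched normal component 𝒦(λ,ε) = ((1+λ)/2) F₁(εM, y; μ(ε)) + ((1−λ)/2) F₁(−εM, y; μ(ε)) + ε²(λ²−1)(M²/2) B. Then there exist ε₁ ∈ (0,ε₀) and a continuous function λ* : [0,ε₁) → (−1,1) with λ*(0) = m/M such that 𝒦(λ*(ε), ε) = 0 for all ε ∈ [0,ε₁). -/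
open Filter Topology

/-- L'Hôpital form of the second-order Taylor expansion at the right of `0`. -/
theorem tendsto_div_sq_nhdsGT_zero {f fd : ℝ → ℝ} {D : ℝ}
    (hf : ∀ᶠ x in 𝓝[>] (0 : ℝ), HasDerivAt f (fd x) x)
    (hf0 : Tendsto f (𝓝[>] 0) (𝓝 0))
    (hfd : Tendsto (fun x => fd x / x) (𝓝[>] 0) (𝓝 D)) :
    Tendsto (fun x => f x / x ^ 2) (𝓝[>] 0) (𝓝 (D / 2)) := by
  refine HasDerivAt.lhopital_zero_nhdsGT (f' := fd) (g' := fun x => 2 * x) hf ?_ ?_ hf0 ?_ ?_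
  · exact Eventually.of_forall fun x => by simpa using hasDerivAt_pow 2 x
  · filter_upwards [self_mem_nhdsWithin] with x hx
    have : (0 : ℝ) < x := hx
    positivity
  · have : Tendsto (fun x : ℝ => x ^ 2) (𝓝 0) (𝓝 (0 ^ 2)) := (continuous_pow 2).tendsto 0
    simpa using this.mono_left nhdsWithin_le_nhds
  · refine (hfd.div_const 2).congr fun x => ?_
    rw [div_div, mul_comm]

/-- The right-sided difference quotient at `0` of a function vanishing there. -/
theorem HasDerivWithinAt.tendsto_div_nhdsGT_zero {f : ℝ → ℝ} {D ε₀ : ℝ} (hε₀ : 0 < ε₀)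
    (h : HasDerivWithinAt f D (Set.Ico 0 ε₀) 0) (h0 : f 0 = 0) :
    Tendsto (fun x => f x / x) (𝓝[>] 0) (𝓝 D) := by
  have h1 := hasDerivWithinAt_iff_tendsto_slope.1 h
  have h2 : 𝓝[Set.Ico 0 ε₀ \ {0}] (0 : ℝ) = 𝓝[>] 0 := by
    rw [Set.Ico_sdiff_left]
    exact nhdsWithin_Ioo_eq_nhdsGT hε₀
  rw [h2] at h1
  refine h1.congr fun x => ?_
  simp [slope_def_field, h0]

/-- A `C²` function of two variables whose value and first `x`-derivative vanish at the origin,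
evaluated along `(cε, μ ε)` with `μ ε ∼ (μdd / 2) ε²`. -/
theorem tendsto_comp_div_sq {G : ℝ × ℝ → ℝ} (hG : ContDiff ℝ 2 G) (hG0 : G (0, 0) = 0)
    (hGx : deriv (fun x => G (x, 0)) 0 = 0) {μ : ℝ → ℝ} {μdd : ℝ}
    (hμ0 : Tendsto μ (𝓝[>] 0) (𝓝 0))
    (hμ : Tendsto (fun x => μ x / x ^ 2) (𝓝[>] 0) (𝓝 (μdd / 2))) (c : ℝ) :
    Tendsto (fun ε => G (ε * c, μ ε) / ε ^ 2) (𝓝[>] 0)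
      (𝓝 ((c ^ 2 * deriv (fun x => deriv (fun x' => G (x', 0)) x) 0 +
        μdd * deriv (fun s => G (0, s)) 0) / 2)) := by
  set g : ℝ → ℝ := fun x => G (x, 0) with hg
  have hgC : ContDiff ℝ 2 g := hG.comp (contDiff_id.prodMk contDiff_const)
  have hgd : Differentiable ℝ g := hgC.differentiable (by norm_num)
  have hgdC : ContDiff ℝ 1 (deriv g) := by
    have := (contDiff_succ_iff_deriv (n := 1) (f := g)).1 (by simpa [one_add_one_eq_two] using hgC)
    exact this.2.2
  have hgdd : HasDerivAt (deriv g) (deriv (deriv g) 0) 0 :=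
    (hgdC.differentiable (by norm_num) 0).hasDerivAt
  have hε : Tendsto (fun ε : ℝ => ε * c) (𝓝[>] 0) (𝓝 0) := by
    have : Tendsto (fun ε : ℝ => ε * c) (𝓝 0) (𝓝 (0 * c)) :=
      (continuous_id.mul continuous_const).tendsto 0
    simpa using this.mono_left nhdsWithin_le_nhds
  have h1 : Tendsto (fun ε => g (ε * c) / ε ^ 2) (𝓝[>] 0)
      (𝓝 (c ^ 2 * deriv (deriv g) 0 / 2)) := by
    apply tendsto_div_sq_nhdsGT_zero (fd := fun ε => deriv g (ε * c) * c)
    · refine Eventually.of_forall fun x => ?_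
      have := (hgd (x * c)).hasDerivAt.comp x ((hasDerivAt_id x).mul_const c)
      simpa [Function.comp_def] using this
    · have : Tendsto g (𝓝 0) (𝓝 0) := by
        simpa [hg, hG0] using hgC.continuous.tendsto 0
      exact this.comp hε
    · have h3 : HasDerivAt (fun ε => deriv g (ε * c) * c) (deriv (deriv g) 0 * c * c) 0 := by
        have h4 : HasDerivAt (deriv g) (deriv (deriv g) 0) ((0 : ℝ) * c) := by simpa using hgdd
        have := (h4.comp (0 : ℝ) ((hasDerivAt_id (0 : ℝ)).mul_const c)).mul_const c
        simpa [Function.comp_def] using this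
      have h5 := HasDerivWithinAt.tendsto_div_nhdsGT_zero (ε₀ := 1) one_pos
        h3.hasDerivWithinAt (by simp [hGx])
      convert h5 using 2
      ring
  have hGd : HasStrictFDerivAt G (fderiv ℝ G (0, 0)) (0, 0) :=
    hG.contDiffAt.hasStrictFDerivAt (by norm_num)
  have hGs : fderiv ℝ G (0, 0) (0, 1) = deriv (fun s => G (0, s)) 0 := by
    have h6 : HasDerivAt (fun s : ℝ => ((0 : ℝ), s)) (0, 1) 0 :=
      (hasDerivAt_const 0 0).prodMk (hasDerivAt_id 0)
    exact (hGd.hasFDerivAt.comp_hasDerivAt (0 : ℝ) h6).deriv.symm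
  have hlim : Tendsto (fun ε => ((ε * c, μ ε), (ε * c, (0 : ℝ)))) (𝓝[>] 0)
      (𝓝 (((0 : ℝ), (0 : ℝ)), ((0 : ℝ), (0 : ℝ)))) :=
    (hε.prodMk_nhds hμ0).prodMk_nhds (hε.prodMk_nhds tendsto_const_nhds)
  have ho := hGd.isLittleO.comp_tendsto hlim
  have hO : (fun ε => ((ε * c, μ ε) : ℝ × ℝ) - (ε * c, 0)) =O[𝓝[>] 0] fun ε : ℝ => ε ^ 2 := by
    have h7 : μ =O[𝓝[>] 0] fun ε : ℝ => ε ^ 2 := by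
      refine Asymptotics.isBigO_of_div_tendsto_nhds ?_ _ hμ
      filter_upwards [self_mem_nhdsWithin] with x hx h
      exact absurd h (pow_ne_zero 2 (ne_of_gt hx))
    refine (Asymptotics.isBigO_of_le _ fun ε => ?_).trans h7
    simp
  have h8 := (ho.trans_isBigO hO).tendsto_div_nhds_zero
  have h9 := (h8.add (hμ.mul_const (deriv (fun s => G (0, s)) 0))).add h1
  convert h9 using 1
  · funext ε
    have : fderiv ℝ G (0, 0) (((ε * c, μ ε) : ℝ × ℝ) - (ε * c, 0)) =
        μ ε * deriv (fun s => G (0, s)) 0 := by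
      rw [← hGs, ← smul_eq_mul (μ ε), ← map_smul]
      simp
    simp only [Function.comp, this, hg]
    ring
  · congr 1
    ring

theorem continuousOn_update_Ico {f : ℝ → ℝ} {ε₀ L : ℝ}
    (hf : ContinuousOn f (Set.Ico 0 ε₀))
    (hL : Tendsto (fun ε => f ε / ε ^ 2) (𝓝[>] 0) (𝓝 L)) :
    ContinuousOn (Function.update (fun ε => f ε / ε ^ 2) 0 L) (Set.Ico 0 ε₀) := by
  rw [continuousOn_update_iff]
  refine ⟨(hf.mono Set.sdiff_subset).div (by fun_prop) fun x hx => pow_ne_zero 2 hx.2, fun _ => ?_⟩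
  rw [Set.Ico_sdiff_left]
  exact hL.mono_left (nhdsWithin_mono _ Set.Ioo_subset_Ioi_self)

/-- A continuous branch of roots of `ε² (λ² + β λ + α)`, where the coefficients are built from
functions `P`, `N` with the same leading coefficient at order `ε²`. -/
theorem exists_continuousOn_root {P N : ℝ → ℝ} {ε₀ L k r : ℝ} (hε₀ : 0 < ε₀)
    (hP : ContinuousOn P (Set.Ico 0 ε₀)) (hN : ContinuousOn N (Set.Ico 0 ε₀))
    (hP0 : P 0 = 0) (hN0 : N 0 = 0)
    (hPL : Tendsto (fun ε => P ε / ε ^ 2) (𝓝[>] 0) (𝓝 L))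
    (hNL : Tendsto (fun ε => N ε / ε ^ 2) (𝓝[>] 0) (𝓝 L))
    (hk : k ≠ 0) (hr : r ≠ 0) (hr1 : |r| < 1) (hrel : L = k * (1 - r ^ 2)) :
    ∃ ε₁ : ℝ, 0 < ε₁ ∧ ε₁ < ε₀ ∧ ∃ lam : ℝ → ℝ,
      ContinuousOn lam (Set.Ico 0 ε₁) ∧ lam 0 = r ∧
      ∀ ε ∈ Set.Ico (0 : ℝ) ε₁, lam ε ∈ Set.Ioo (-1 : ℝ) 1 ∧
        ((1 + lam ε) / 2) * P ε + ((1 - lam ε) / 2) * N ε +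
          ε ^ 2 * ((lam ε) ^ 2 - 1) * k = 0 := by
  set p := Function.update (fun ε => P ε / ε ^ 2) 0 L with hp
  set n := Function.update (fun ε => N ε / ε ^ 2) 0 L with hn
  have hpc : ContinuousOn p (Set.Ico 0 ε₀) := continuousOn_update_Ico hP hPL
  have hnc : ContinuousOn n (Set.Ico 0 ε₀) := continuousOn_update_Ico hN hNL
  have hp0 : p 0 = L := by simp [hp]
  have hn0 : n 0 = L := by simp [hn]
  have hpP : ∀ ε, P ε = ε ^ 2 * p ε := fun ε => by
    rcases eq_or_ne ε 0 with rfl | h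
    · simp [hP0]
    · simp only [hp, Function.update_of_ne h]; field_simp
  have hnN : ∀ ε, N ε = ε ^ 2 * n ε := fun ε => by
    rcases eq_or_ne ε 0 with rfl | h
    · simp [hN0]
    · simp only [hn, Function.update_of_ne h]; field_simp
  set b : ℝ → ℝ := fun ε => (p ε - n ε) / (2 * k) with hb
  set d : ℝ → ℝ := fun ε => b ε ^ 2 - 4 * ((p ε + n ε) / (2 * k) - 1) with hd
  set lam : ℝ → ℝ := fun ε => (-b ε + r / |r| * √(d ε)) / 2 with hlam
  have hbc : ContinuousOn b (Set.Ico 0 ε₀) := (hpc.sub hnc).div_const _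
  have hdc : ContinuousOn d (Set.Ico 0 ε₀) :=
    (hbc.pow 2).sub ((((hpc.add hnc).div_const _).sub continuousOn_const).const_mul 4)
  have hlc : ContinuousOn lam (Set.Ico 0 ε₀) :=
    (hbc.neg.add (hdc.sqrt.const_mul _)).div_const 2
  have hb0 : b 0 = 0 := by simp [hb, hp0, hn0]
  have hd0 : d 0 = (2 * |r|) ^ 2 := by
    simp only [hd, hb0, hp0, hn0, hrel, mul_pow, sq_abs]
    field_simp
    ring
  have hra : 0 < |r| := abs_pos.2 hr
  have hl0 : lam 0 = r := by
    simp only [hlam, hb0, hd0, Real.sqrt_sq (by positivity : 0 ≤ 2 * |r|)]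
    field_simp
    ring
  have h0 : (0 : ℝ) ∈ Set.Ico 0 ε₀ := ⟨le_rfl, hε₀⟩
  have e1 : ∀ᶠ ε in 𝓝[Set.Ico 0 ε₀] 0, 0 < d ε :=
    (hdc 0 h0).eventually (lt_mem_nhds (by rw [hd0]; positivity))
  have e2 : ∀ᶠ ε in 𝓝[Set.Ico 0 ε₀] 0, lam ε ∈ Set.Ioo (-1 : ℝ) 1 :=
    (hlc 0 h0).eventually (Ioo_mem_nhds (by rw [hl0]; exact (abs_lt.1 hr1).1)
      (by rw [hl0]; exact (abs_lt.1 hr1).2))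
  have e3 := e1.and e2
  rw [eventually_nhdsWithin_iff, Metric.eventually_nhds_iff] at e3
  obtain ⟨δ, hδ, h⟩ := e3
  refine ⟨min δ (ε₀ / 2), by positivity, (min_le_right _ _).trans_lt (by linarith), lam,
    hlc.mono fun x hx => ⟨hx.1, hx.2.trans ((min_le_right _ _).trans_lt (by linarith))⟩, hl0,
    fun ε hε => ?_⟩
  have hεδ : ε < δ := hε.2.trans_le (min_le_left _ _)
  have hε2 : ε < ε₀ := hε.2.trans_le ((min_le_right _ _).trans (by linarith))
  obtain ⟨hdpos, hmem⟩ := h (by simpa [Real.dist_eq, abs_of_nonneg hε.1] using hεδ) ⟨hε.1, hε2⟩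
  refine ⟨hmem, ?_⟩
  have hs : (r / |r|) ^ 2 = 1 := by
    rw [div_pow, sq_abs, div_self (pow_ne_zero 2 hr)]
  have hq : (2 * lam ε + b ε) ^ 2 = d ε := by
    have : 2 * lam ε + b ε = r / |r| * √(d ε) := by simp only [hlam]; ring
    rw [this, mul_pow, hs, one_mul, Real.sq_sqrt hdpos.le]
  have hbk : b ε * (2 * k) = p ε - n ε := by simp only [hb]; field_simp
  have hq' : (2 * lam ε + b ε) ^ 2 * k = b ε ^ 2 * k - 2 * (p ε + n ε) + 4 * k := by
    rw [hq]; simp only [hd]; field_simp; ring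
  rw [hpP, hnN]
  linear_combination ε ^ 2 / 4 * hq' - ε ^ 2 * lam ε / 2 * hbk


theorem stmt13 (m : ℕ) (U : Set (Fin m → ℝ)) (hU : IsOpen U)
    (y : Fin m → ℝ) (hy : y ∈ U)
    (F1 : ℝ → (Fin m → ℝ) → ℝ → ℝ)
    (hF1 : ContDiff ℝ 2 (fun z : ℝ × (Fin m → ℝ) × ℝ => F1 z.1 z.2.1 z.2.2))
    (ε₀ : ℝ) (hε₀ : 0 < ε₀)
    -- μ is C² on [0,ε₀) with μ(0) = μ′(0) = 0, second derivative μ″(0) = μdd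
    (μ : ℝ → ℝ) (μd : ℝ → ℝ) (μdd : ℝ)
    (hμd : ∀ ε ∈ Set.Ico (0 : ℝ) ε₀, HasDerivWithinAt μ (μd ε) (Set.Ico 0 ε₀) ε)
    (hμdc : ContinuousOn μd (Set.Ico 0 ε₀))
    (hμdd : HasDerivWithinAt μd μdd (Set.Ico 0 ε₀) 0)
    (hμ0 : μ 0 = 0) (hμd0 : μd 0 = 0)
    (hF10 : F1 0 y 0 = 0)
    (hFx : deriv (fun x => F1 x y 0) 0 = 0)
    (Mc mval : ℝ) (hMc : 0 < Mc)
    (hB : deriv (fun x => deriv (fun x' => F1 x' y 0) x) 0 ≠ 0)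
    (hm0 : 0 < |mval|) (hmM : |mval| < Mc)
    (hrel : μdd * deriv (fun s => F1 0 y s) 0 +
      mval ^ 2 * deriv (fun x => deriv (fun x' => F1 x' y 0) x) 0 = 0) :
    ∃ ε₁ : ℝ, 0 < ε₁ ∧ ε₁ < ε₀ ∧ ∃ lam : ℝ → ℝ,
      ContinuousOn lam (Set.Ico 0 ε₁) ∧ lam 0 = mval / Mc ∧
      ∀ ε ∈ Set.Ico (0 : ℝ) ε₁, lam ε ∈ Set.Ioo (-1 : ℝ) 1 ∧
        ((1 + lam ε) / 2) * F1 (ε * Mc) y (μ ε) +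
          ((1 - lam ε) / 2) * F1 (-(ε * Mc)) y (μ ε) +
          ε ^ 2 * ((lam ε) ^ 2 - 1) * (Mc ^ 2 / 2) *
            deriv (fun x => deriv (fun x' => F1 x' y 0) x) 0 = 0 := by
  set B := deriv (fun x => deriv (fun x' => F1 x' y 0) x) 0 with hBdef
  have hG : ContDiff ℝ 2 (fun z : ℝ × ℝ => F1 z.1 y z.2) :=
    hF1.comp (contDiff_fst.prodMk (contDiff_const.prodMk contDiff_snd))
  have h0 : (0 : ℝ) ∈ Set.Ico 0 ε₀ := ⟨le_rfl, hε₀⟩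
  have hμc : ContinuousOn μ (Set.Ico 0 ε₀) := fun ε hε => (hμd ε hε).continuousWithinAt
  have hμt : Tendsto μ (𝓝[>] 0) (𝓝 0) := by
    have h1 := ((hμc 0 h0).mono Set.Ioo_subset_Ico_self).tendsto
    rwa [nhdsWithin_Ioo_eq_nhdsGT hε₀, hμ0] at h1
  have hμ2 : Tendsto (fun x => μ x / x ^ 2) (𝓝[>] 0) (𝓝 (μdd / 2)) := by
    refine tendsto_div_sq_nhdsGT_zero (fd := μd) ?_ hμt (hμdd.tendsto_div_nhdsGT_zero hε₀ hμd0)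
    filter_upwards [Ioo_mem_nhdsGT hε₀] with x hx
    exact (hμd x ⟨hx.1.le, hx.2⟩).hasDerivAt (Ico_mem_nhds hx.1 hx.2)
  have key := tendsto_comp_div_sq hG hF10 hFx hμt hμ2
  have hP := key Mc
  have hN := key (-Mc)
  simp only [neg_sq, mul_neg] at hP hN
  have hcont : ∀ c : ℝ, ContinuousOn (fun ε => F1 (ε * c) y (μ ε)) (Set.Ico 0 ε₀) := fun c =>
    hG.continuous.comp_continuousOn ((continuousOn_id.mul continuousOn_const).prodMk hμc)
  have hNc := hcont (-Mc)
  simp only [mul_neg] at hNc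
  obtain ⟨ε₁, h1, h2, lam, h3, h4, h5⟩ := exists_continuousOn_root (k := Mc ^ 2 / 2 * B)
    (r := mval / Mc) hε₀ (hcont Mc) hNc (by simp [hμ0, hF10]) (by simp [hμ0, hF10]) hP hN
    (mul_ne_zero (by positivity) hB) (div_ne_zero (abs_pos.1 hm0) hMc.ne')
    (by rw [abs_div, abs_of_pos hMc, div_lt_one hMc]; exact hmM)
    (by
      rw [← hBdef]
      field_simp
      linear_combination hrel)
  refine ⟨ε₁, h1, h2, lam, h3, h4, fun ε hε => ⟨(h5 ε hε).1, ?_⟩⟩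
  rw [mul_assoc (ε ^ 2 * (lam ε ^ 2 - 1))]
  exact (h5 ε hε).2
end
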